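/- Let p ≥ 0 and ν ∈ {0,…,p} with ν odd, x ∈ (0,1), S invertible, and suppose the design is equidistant: x_j = (j−1)/(N−1) for j = 1,…,N. Assume ρ is continuous, symmetric, and four times continuously differentiable on a neighborhood of (x,x), and let (h_N) be positive bandwidths with h_N → 0 and N h_N⁵ → ∞. With Σ_N = (ρ(x_i,x_j))_{i,j} and V_N = e_νᵀ (X_NᵀW_N X_N)^{-1} X_NᵀW_N Σ_N W_N X_N (X_NᵀW_N X_N)^{-1} e_ν, for all sufficiently large N the matrix X_NᵀW_N X_N is invertible and h_N^{-4} [ h_N^{2ν} V_N − h_N² ρ^{(1,1)}(x,x) e_νᵀ S^{-1} A₂ S^{-1} e_ν − h_N⁴ ρ^{(1,3)}(x,x) e_νᵀ S^{-1} A₃ S^{-1} e_ν ] → 0 as N → ∞, where A₂ = (μ_{k+1} μ_{l+1}) and A₃ = ( (μ_{k+3} μ_{l+1} + μ_{k+1} μ_{l+3})/6 ) are (p+1)×(p+1) matrices, ρ^{(1,1)} is the mixed second partial derivative of ρ, and ρ^{(1,3)} is the mixed partial derivative of order 1 in the first variable and 3 in the second. -/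

import Mathlib

open MeasureTheory Set Filter Topology Matrix

/-- `j`-th moment of the kernel `K`. -/
noncomputable def kmom (K : ℝ → ℝ) (j : ℕ) : ℝ := ∫ u in (-1:ℝ)..1, u ^ j * K u

/-- The matrix `S = (μ_{k+l})`. -/
noncomputable def Smat (K : ℝ → ℝ) (p : ℕ) : Matrix (Fin (p + 1)) (Fin (p + 1)) ℝ :=
  Matrix.of fun k l => kmom K ((k : ℕ) + (l : ℕ))

/-- The matrix `A₂ = (μ_{k+1} μ_{l+1})`. -/
noncomputable def A2mat (K : ℝ → ℝ) (p : ℕ) : Matrix (Fin (p + 1)) (Fin (p + 1)) ℝ :=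
  Matrix.of fun k l => kmom K ((k : ℕ) + 1) * kmom K ((l : ℕ) + 1)

/-- The matrix `A₃ = ((μ_{k+3} μ_{l+1} + μ_{k+1} μ_{l+3})/6)`. -/
noncomputable def A3mat (K : ℝ → ℝ) (p : ℕ) : Matrix (Fin (p + 1)) (Fin (p + 1)) ℝ :=
  Matrix.of fun k l =>
    (kmom K ((k : ℕ) + 3) * kmom K ((l : ℕ) + 1)
      + kmom K ((k : ℕ) + 1) * kmom K ((l : ℕ) + 3)) / 6

/-- Mixed partial derivative `∂₁^i ∂₂^j ρ (x,x)`. -/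
noncomputable def mixedPD (ρ : ℝ → ℝ → ℝ) (i j : ℕ) (x : ℝ) : ℝ :=
  iteratedDeriv i (fun y => iteratedDeriv j (fun z => ρ y z) x) x

/-- Equidistant design points `x_j = (j − 1)/(N − 1)`, `j = 1,…,N`. -/
noncomputable def xdEq (N j : ℕ) : ℝ := ((j : ℝ) - 1) / ((N : ℝ) - 1)

/-- The design matrix `X_N` with `(j,k)` entry `(x_j − x)^k`. -/
noncomputable def Xmat (xd : ℕ → ℕ → ℝ) (x : ℝ) (p N : ℕ) :
    Matrix (Fin N) (Fin (p + 1)) ℝ :=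
  Matrix.of fun j k => (xd N ((j : ℕ) + 1) - x) ^ (k : ℕ)

/-- The weight matrix `W_N = diag(h⁻¹ K((x_j − x)/h))`. -/
noncomputable def Wmat (K : ℝ → ℝ) (xd : ℕ → ℕ → ℝ) (x h : ℝ) (N : ℕ) :
    Matrix (Fin N) (Fin N) ℝ :=
  Matrix.diagonal fun j => h⁻¹ * K ((xd N ((j : ℕ) + 1) - x) / h)

/-- The covariance matrix `Σ_N = (ρ(x_i, x_j))`. -/
noncomputable def Sigmat (ρ : ℝ → ℝ → ℝ) (xd : ℕ → ℕ → ℝ) (N : ℕ) :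
    Matrix (Fin N) (Fin N) ℝ :=
  Matrix.of fun i j => ρ (xd N ((i : ℕ) + 1)) (xd N ((j : ℕ) + 1))

/-- The normalized variance `V_N = e_νᵀ (XᵀWX)⁻¹ XᵀW Σ_N W X (XᵀWX)⁻¹ e_ν`. -/
noncomputable def VN (K : ℝ → ℝ) (xd : ℕ → ℕ → ℝ) (ρ : ℝ → ℝ → ℝ) (x h : ℝ)
    (p N : ℕ) (ν : Fin (p + 1)) : ℝ :=
  (((Xmat xd x p N)ᵀ * Wmat K xd x h N * Xmat xd x p N)⁻¹ *
    ((Xmat xd x p N)ᵀ * Wmat K xd x h N) * Sigmat ρ xd N *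
    (Wmat K xd x h N * Xmat xd x p N) *
    ((Xmat xd x p N)ᵀ * Wmat K xd x h N * Xmat xd x p N)⁻¹) ν ν

/-- The Taylor polynomial of `ρ` at `(x, x)` of total degree at most `n`, in the increments
`s` and `t`. -/
noncomputable def taylorPoly₂ (ρ : ℝ → ℝ → ℝ) (x : ℝ) (n : ℕ) (s t : ℝ) : ℝ :=
  ∑ j ∈ Finset.range (n + 1), ∑ i ∈ Finset.range (n + 1 - j),
    mixedPD ρ i j x / (i.factorial * j.factorial) * s ^ i * t ^ j

theorem mixedPD_succ (ρ : ℝ → ℝ → ℝ) (i j : ℕ) (x : ℝ) :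
    mixedPD ρ i (j + 1) x = mixedPD (fun y z => deriv (ρ y) z) i j x := by
  simp only [mixedPD, iteratedDeriv_succ']

/-- Peano's form of Taylor's theorem for a function smooth near the base point. -/
theorem ContDiffAt.taylor_isLittleO {f : ℝ → ℝ} {x : ℝ} {n : ℕ} (hf : ContDiffAt ℝ n f x) :
    (fun y => f y - ∑ i ∈ Finset.range (n + 1), iteratedDeriv i f x / i.factorial * (y - x) ^ i)
      =o[𝓝 x] fun y => (y - x) ^ n := by
  obtain ⟨r, hr, hball⟩ := Metric.eventually_nhds_iff_ball.1 (hf.eventually (by simp))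
  have h := _root_.taylor_isLittleO (convex_ball x r) (Metric.mem_ball_self hr)
    (fun y hy => (hball y hy).contDiffWithinAt)
  rw [Metric.isOpen_ball.nhdsWithin_eq (Metric.mem_ball_self hr)] at h
  refine h.congr_left fun y => ?_
  rw [taylor_within_apply]
  congr 1
  refine Finset.sum_congr rfl fun i _ => ?_
  rw [iteratedDerivWithin_of_isOpen Metric.isOpen_ball (Metric.mem_ball_self hr), smul_eq_mul]
  ring

/-- The partial derivative in the second variable as a Fréchet derivative. -/
theorem hasDerivAt_snd_of_differentiableAt {ρ : ℝ → ℝ → ℝ} {s t : ℝ}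
    (h : DifferentiableAt ℝ (fun q : ℝ × ℝ => ρ q.1 q.2) (s, t)) :
    HasDerivAt (ρ s) (fderiv ℝ (fun q : ℝ × ℝ => ρ q.1 q.2) (s, t) (0, 1)) t := by
  have h1 : HasDerivAt (fun z : ℝ => ((s, z) : ℝ × ℝ)) (0, 1) t :=
    (hasDerivAt_const t s).prodMk (hasDerivAt_id t)
  exact h.hasFDerivAt.comp_hasDerivAt t h1

theorem ContDiffAt.deriv_snd {ρ : ℝ → ℝ → ℝ} {q₀ : ℝ × ℝ} {n : ℕ}
    (h : ContDiffAt ℝ (n + 1 : ℕ) (fun q : ℝ × ℝ => ρ q.1 q.2) q₀) :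
    ContDiffAt ℝ n (fun q : ℝ × ℝ => deriv (ρ q.1) q.2) q₀ := by
  have h1 : ContDiffAt ℝ n
      (fun q => fderiv ℝ (fun q : ℝ × ℝ => ρ q.1 q.2) q ((0 : ℝ), (1 : ℝ))) q₀ :=
    (h.fderiv_right (m := n) (by norm_cast)).clm_apply contDiffAt_const
  refine h1.congr_of_eventuallyEq ?_
  filter_upwards [h.eventually (by simp)] with q hq
  exact (hasDerivAt_snd_of_differentiableAt (hq.differentiableAt (by simp))).deriv

theorem hasDerivAt_taylorPoly₂ (ρ : ℝ → ℝ → ℝ) (x : ℝ) (n : ℕ) (s t : ℝ) :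
    HasDerivAt (fun t => taylorPoly₂ ρ x (n + 1) s (t - x))
      (taylorPoly₂ (fun y z => deriv (ρ y) z) x n s (t - x)) t := by
  unfold taylorPoly₂
  have key : ∀ j ∈ Finset.range (n + 1 + 1), HasDerivAt (fun t : ℝ =>
      ∑ i ∈ Finset.range (n + 1 + 1 - j),
        mixedPD ρ i j x / (i.factorial * j.factorial) * s ^ i * (t - x) ^ j)
      (∑ i ∈ Finset.range (n + 1 + 1 - j),
        mixedPD ρ i j x / (i.factorial * j.factorial) * s ^ i * (j * (t - x) ^ (j - 1))) t := by
    intro j _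
    refine HasDerivAt.fun_sum fun i _ => HasDerivAt.const_mul _ ?_
    simpa using ((hasDerivAt_id t).sub_const x).fun_pow j
  refine (HasDerivAt.fun_sum key).congr_deriv ?_
  rw [Finset.sum_range_succ']
  simp only [Nat.cast_zero, zero_mul, mul_zero, Finset.sum_const_zero, add_zero,
    Nat.add_sub_add_right, Nat.add_sub_cancel]
  refine Finset.sum_congr rfl fun j _ => Finset.sum_congr rfl fun i _ => ?_
  rw [← mixedPD_succ, Nat.factorial_succ]
  have := Nat.factorial_ne_zero i
  have := Nat.factorial_ne_zero j
  push_cast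
  field_simp

theorem taylorPoly₂_zero_right (ρ : ℝ → ℝ → ℝ) (x : ℝ) (n : ℕ) (s : ℝ) :
    taylorPoly₂ ρ x n s 0 = ∑ i ∈ Finset.range (n + 1),
      iteratedDeriv i (fun y => ρ y x) x / i.factorial * s ^ i := by
  simp [taylorPoly₂, Finset.sum_range_succ', mixedPD]

/-- Peano's form of Taylor's theorem in two variables. -/
theorem ContDiffAt.taylorPoly₂_isLittleO {x : ℝ} (n : ℕ) {ρ : ℝ → ℝ → ℝ}
    (h : ContDiffAt ℝ n (fun q : ℝ × ℝ => ρ q.1 q.2) (x, x)) :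
    (fun q : ℝ × ℝ => ρ q.1 q.2 - taylorPoly₂ ρ x n (q.1 - x) (q.2 - x))
      =o[𝓝 (x, x)] fun q => ‖q - (x, x)‖ ^ n := by
  induction n generalizing ρ with
  | zero =>
    simpa [taylorPoly₂, mixedPD, tendsto_sub_nhds_zero_iff] using h.continuousAt.tendsto
  | succ n ih =>
    have hd := ih (ρ := fun y z => deriv (ρ y) z) h.deriv_snd
    have hs : ContDiffAt ℝ (n + 1 : ℕ) (fun y => ρ y x) x :=
      h.comp (f := fun y : ℝ => ((y, x) : ℝ × ℝ)) x (contDiffAt_id.prodMk contDiffAt_const)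
    have hfst : Tendsto (Prod.fst : ℝ × ℝ → ℝ) (𝓝 (x, x)) (𝓝 x) := continuous_fst.tendsto (x, x)
    have h1 := hs.taylor_isLittleO.comp_tendsto hfst
    rw [Asymptotics.isLittleO_iff] at hd h1 ⊢
    intro ε hε
    obtain ⟨r, hr, hball⟩ := Metric.eventually_nhds_iff_ball.1
      ((hd (half_pos hε)).and (h.eventually (by simp)))
    filter_upwards [h1 (half_pos hε), Metric.ball_mem_nhds (x, x) hr] with q hq hqr
    obtain ⟨s, t⟩ := q
    have hmem : ∀ t' ∈ segment ℝ x t, ‖((s, t') : ℝ × ℝ) - (x, x)‖ ≤ ‖((s, t) : ℝ × ℝ) - (x, x)‖ := by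
      intro t' ht'
      rw [segment_eq_uIcc] at ht'
      simp only [Prod.mk_sub_mk, Prod.norm_mk, Real.norm_eq_abs]
      exact max_le_max le_rfl (abs_sub_left_of_mem_uIcc ht')
    have hin : ∀ t' ∈ segment ℝ x t, ((s, t') : ℝ × ℝ) ∈ Metric.ball ((x, x) : ℝ × ℝ) r := by
      intro t' ht'
      rw [mem_ball_iff_norm] at hqr ⊢
      exact (hmem t' ht').trans_lt hqr
    have hmv := (convex_segment x t).norm_image_sub_le_of_norm_hasDerivWithin_le
      (f := fun z => ρ s z - taylorPoly₂ ρ x (n + 1) (s - x) (z - x))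
      (f' := fun z => deriv (ρ s) z
        - taylorPoly₂ (fun y z => deriv (ρ y) z) x n (s - x) (z - x))
      (C := ε / 2 * ‖((s, t) : ℝ × ℝ) - (x, x)‖ ^ n)
      (fun z hz => by
        have hdz := hasDerivAt_snd_of_differentiableAt
          ((hball _ (hin z hz)).2.differentiableAt (by simp))
        rw [← hdz.deriv] at hdz
        exact (hdz.sub (hasDerivAt_taylorPoly₂ ρ x n (s - x) z)).hasDerivWithinAt)
      (fun z hz => by
        refine (hball _ (hin z hz)).1.trans ?_
        rw [norm_pow, norm_norm]
        gcongr
        exact hmem z hz)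
      (left_mem_segment ℝ x t) (right_mem_segment ℝ x t)
    simp only [Function.comp_apply, sub_self, taylorPoly₂_zero_right] at hq hmv
    have hs_le : ‖s - x‖ ≤ ‖((s, t) : ℝ × ℝ) - (x, x)‖ := le_max_left _ _
    have ht_le : ‖t - x‖ ≤ ‖((s, t) : ℝ × ℝ) - (x, x)‖ := le_max_right _ _
    rw [norm_pow] at hq
    rw [norm_pow, norm_norm]
    set M := ‖((s, t) : ℝ × ℝ) - (x, x)‖
    have e1 : ε / 2 * ‖s - x‖ ^ (n + 1) ≤ ε / 2 * M ^ (n + 1) := by gcongr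
    have e2 : ε / 2 * M ^ n * ‖t - x‖ ≤ ε / 2 * M ^ n * M := by gcongr
    refine (norm_le_norm_add_norm_sub' _ (ρ s x - ∑ i ∈ Finset.range (n + 1 + 1),
      iteratedDeriv i (fun y => ρ y x) x / i.factorial * (s - x) ^ i)).trans ?_
    refine (add_le_add (hq.trans e1) (hmv.trans e2)).trans (le_of_eq ?_)
    ring

theorem ContDiffAt.taylorPoly₂_line_isLittleO {x : ℝ} {n : ℕ} {ρ : ℝ → ℝ → ℝ}
    (h : ContDiffAt ℝ n (fun q : ℝ × ℝ => ρ q.1 q.2) (x, x)) (a b : ℝ) :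
    (fun r : ℝ => ρ (x + a * r) (x + b * r) - taylorPoly₂ ρ x n (a * r) (b * r))
      =o[𝓝 0] fun r => r ^ n := by
  have hc : Continuous (fun r : ℝ => ((x + a * r, x + b * r) : ℝ × ℝ)) := by fun_prop
  have ht : Tendsto (fun r : ℝ => ((x + a * r, x + b * r) : ℝ × ℝ)) (𝓝 0) (𝓝 (x, x)) := by
    simpa using hc.tendsto 0
  have h1 := (h.taylorPoly₂_isLittleO n).comp_tendsto ht
  have h2 : (fun r : ℝ => ρ (x + a * r) (x + b * r) - taylorPoly₂ ρ x n (a * r) (b * r))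
      =o[𝓝 0] fun r => ‖((a * r, b * r) : ℝ × ℝ)‖ ^ n := by
    refine h1.congr (fun r => by simp) (fun r => by simp)
  refine h2.trans_isBigO (Asymptotics.IsBigO.pow ?_ n)
  refine Asymptotics.IsBigO.of_bound ‖((a, b) : ℝ × ℝ)‖ (Eventually.of_forall fun r => ?_)
  have hsmul : ((a * r, b * r) : ℝ × ℝ) = r • ((a, b) : ℝ × ℝ) := by simp [mul_comm]
  rw [norm_norm, hsmul, norm_smul, mul_comm]

/-- The fourth-order mixed partial derivatives of a symmetric function agree on the diagonal. -/
theorem mixedPD_three_one_eq {ρ : ℝ → ℝ → ℝ} {x : ℝ}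
    (h : ContDiffAt ℝ 4 (fun q : ℝ × ℝ => ρ q.1 q.2) (x, x))
    (hsym : ∀ᶠ q : ℝ × ℝ in 𝓝 (x, x), ρ q.1 q.2 = ρ q.2 q.1) :
    mixedPD ρ 3 1 x = mixedPD ρ 1 3 x := by
  have h4 : ContDiffAt ℝ (4 : ℕ) (fun q : ℝ × ℝ => ρ q.1 q.2) (x, x) := h
  have hQ : ∀ a b : ℝ, (fun r : ℝ => taylorPoly₂ ρ x 4 (a * r) (b * r)
      - taylorPoly₂ ρ x 4 (b * r) (a * r)) =o[𝓝 0] fun r => r ^ 4 := by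
    intro a b
    have hc : Continuous (fun r : ℝ => ((x + a * r, x + b * r) : ℝ × ℝ)) := by fun_prop
    have ht : Tendsto (fun r : ℝ => ((x + a * r, x + b * r) : ℝ × ℝ)) (𝓝 0) (𝓝 (x, x)) := by
      simpa using hc.tendsto 0
    refine ((h4.taylorPoly₂_line_isLittleO b a).sub
      (h4.taylorPoly₂_line_isLittleO a b)).congr' ?_ EventuallyEq.rfl
    filter_upwards [ht.eventually hsym] with r hr
    rw [hr]
    ring
  have hsum := (((hQ 2 1).add (hQ 1 0)).sub (hQ 2 0)).add
    (((hQ (-2) (-1)).add (hQ (-1) 0)).sub (hQ (-2) 0))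
  have hC : (fun r : ℝ => (2 * (mixedPD ρ 3 1 x - mixedPD ρ 1 3 x)) * r ^ 4)
      =o[𝓝 0] fun r : ℝ => r ^ 4 := by
    refine hsum.congr_left fun r => ?_
    simp [taylorPoly₂, Finset.sum_range_succ, Nat.factorial]
    ring
  by_contra hne
  have hne' : 2 * (mixedPD ρ 3 1 x - mixedPD ρ 1 3 x) ≠ 0 :=
    mul_ne_zero two_ne_zero (sub_ne_zero.2 hne)
  rw [Asymptotics.isLittleO_const_mul_left_iff hne'] at hC
  have hfreq : ∃ᶠ r : ℝ in 𝓝 0, r ^ 4 ≠ 0 := by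
    have hev : ∀ᶠ r : ℝ in 𝓝[≠] 0, r ^ 4 ≠ 0 :=
      eventually_mem_nhdsWithin.mono fun r (hr : r ≠ 0) => pow_ne_zero 4 hr
    exact hev.frequently.filter_mono nhdsWithin_le_nhds
  exact Asymptotics.isLittleO_irrefl hfreq hC

/-- Error of the left Riemann sum with mesh `δ` of a Lipschitz function supported in `[-1, 1]`. -/
theorem abs_riemannSum_sub_integral_le {f : ℝ → ℝ} {C : ℝ}
    (hf : ∀ u v, |f u - f v| ≤ C * |u - v|) (hsupp : ∀ u, u ∉ Icc (-1 : ℝ) 1 → f u = 0)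
    (hcont : Continuous f) {a : ℕ → ℝ} {δ : ℝ} {n : ℕ} (hδ : 0 < δ)
    (ha : ∀ j, a (j + 1) = a j + δ) (ha0 : a 0 < -1) (han : 1 < a n) :
    |δ * ∑ j ∈ Finset.range n, f (a j) - ∫ u in (-1 : ℝ)..1, f u| ≤ C * δ * (2 + 2 * δ) := by
  have hC : 0 ≤ C := by simpa using (abs_nonneg _).trans (hf 1 0)
  have hfi : ∀ s t, IntervalIntegrable f volume s t := fun s t => hcont.intervalIntegrable s t
  have hint : ∫ u in (-1 : ℝ)..1, f u = ∫ u in a 0..a n, f u := by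
    have hz1 : ∫ u in a 0..(-1), f u = 0 := by
      rw [intervalIntegral.integral_of_le ha0.le, integral_Ioc_eq_integral_Ioo]
      exact setIntegral_eq_zero_of_forall_eq_zero fun u hu =>
        hsupp u fun h => absurd h.1 (not_le.2 hu.2)
    have hz2 : ∫ u in (1 : ℝ)..a n, f u = 0 := by
      rw [intervalIntegral.integral_of_le han.le]
      exact setIntegral_eq_zero_of_forall_eq_zero fun u hu =>
        hsupp u fun h => absurd h.2 (not_le.2 hu.1)
    rw [← intervalIntegral.integral_add_adjacent_intervals (hfi (a 0) (-1)) (hfi (-1) (a n)),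
      ← intervalIntegral.integral_add_adjacent_intervals (hfi (-1) 1) (hfi 1 (a n)), hz1, hz2]
    ring
  set g : ℝ → ℝ := (Icc (-1 - δ) (1 + δ)).indicator fun _ => C * δ with hg
  have hgi : Integrable g := (integrable_indicator_iff measurableSet_Icc).2
    continuous_const.integrableOn_Icc
  have hgn : ∀ u, 0 ≤ g u := fun u => indicator_nonneg (fun _ _ => by positivity) u
  have hpiece : ∀ j, |δ * f (a j) - ∫ u in a j..a (j + 1), f u| ≤ ∫ u in a j..a (j + 1), g u := by
    intro j
    have hle : a j ≤ a (j + 1) := by rw [ha]; linarith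
    have hconst : δ * f (a j) = ∫ _ in a j..a (j + 1), f (a j) := by simp [ha]
    rw [hconst, ← intervalIntegral.integral_sub intervalIntegrable_const (hfi _ _),
      ← Real.norm_eq_abs]
    refine intervalIntegral.norm_integral_le_of_norm_le hle
      (Eventually.of_forall fun u hu => ?_) hgi.intervalIntegrable
    rw [ha] at hu
    have hd : |a j - u| ≤ δ := by rw [abs_le]; constructor <;> linarith [hu.1, hu.2]
    by_cases hu' : u ∈ Icc (-1 - δ) (1 + δ)
    · rw [hg, indicator_of_mem hu', Real.norm_eq_abs]
      exact (hf _ _).trans (by gcongr)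
    · rw [hg, indicator_of_notMem hu', hsupp u fun h => hu' ⟨by linarith [h.1], by linarith [h.2]⟩,
        hsupp (a j) fun h => hu' ⟨by linarith [h.1, hu.1], by linarith [h.2, hu.2]⟩]
      simp
  have hmono : a 0 ≤ a n := by linarith
  calc |δ * ∑ j ∈ Finset.range n, f (a j) - ∫ u in (-1 : ℝ)..1, f u|
      = |∑ j ∈ Finset.range n, (δ * f (a j) - ∫ u in a j..a (j + 1), f u)| := by
        rw [Finset.sum_sub_distrib, intervalIntegral.sum_integral_adjacent_intervals
          (fun k _ => hfi _ _), hint, Finset.mul_sum]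
    _ ≤ ∑ j ∈ Finset.range n, |δ * f (a j) - ∫ u in a j..a (j + 1), f u| :=
        Finset.abs_sum_le_sum_abs _ _
    _ ≤ ∑ j ∈ Finset.range n, ∫ u in a j..a (j + 1), g u := Finset.sum_le_sum fun j _ => hpiece j
    _ = ∫ u in a 0..a n, g u :=
        intervalIntegral.sum_integral_adjacent_intervals fun k _ => hgi.intervalIntegrable
    _ ≤ ∫ u, g u := by
        rw [intervalIntegral.integral_of_le hmono]
        exact setIntegral_le_integral hgi (Eventually.of_forall hgn)
    _ = C * δ * (2 + 2 * δ) := by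
        rw [hg, integral_indicator measurableSet_Icc]
        simp only [integral_const, smul_eq_mul, MeasurableSet.univ, measureReal_restrict_apply,
          univ_inter, Real.volume_real_Icc]
        rw [max_eq_left (by linarith)]
        ring

/-- `u ↦ u ^ k * K u` is Lipschitz when `K` is Lipschitz and supported in `[-1, 1]`. -/
theorem abs_pow_mul_sub_pow_mul_le {K : ℝ → ℝ} {L : NNReal} (hK : LipschitzWith L K)
    (hsupp : ∀ u, u ∉ Icc (-1 : ℝ) 1 → K u = 0) (k : ℕ) (u v : ℝ) :
    |u ^ k * K u - v ^ k * K v| ≤ ((3 * k + 1) * L) * |u - v| := by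
  have hlip : ∀ u v, |K u - K v| ≤ L * |u - v| := fun u v => by
    simpa [Real.dist_eq] using hK.dist_le_mul u v
  have hL : (0 : ℝ) ≤ L := L.2
  have hpow : ∀ u ∈ Icc (-1 : ℝ) 1, |u ^ k| ≤ 1 := fun u hu => by
    rw [abs_pow]; exact pow_le_one₀ (abs_nonneg _) (abs_le.2 hu)
  have hout : ∀ u v, u ∈ Icc (-1 : ℝ) 1 → v ∉ Icc (-1 : ℝ) 1 →
      |u ^ k * K u| ≤ ((3 * k + 1) * L) * |u - v| := fun u v hu hv => by
    have h1 := hlip u v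
    rw [hsupp v hv, sub_zero] at h1
    rw [abs_mul]
    calc |u ^ k| * |K u| ≤ 1 * (L * |u - v|) := by gcongr; exact hpow u hu
      _ ≤ ((3 * k + 1) * L) * |u - v| := by
        have : 0 ≤ (k : ℝ) * (L * |u - v|) := by positivity
        linarith
  by_cases hu : u ∈ Icc (-1 : ℝ) 1 <;> by_cases hv : v ∈ Icc (-1 : ℝ) 1
  · have hKv : |K v| ≤ 3 * L := by
      have h1 := hlip v 2
      rw [hsupp 2 (fun h => by linarith [h.2]), sub_zero] at h1
      have h2 : |v - 2| ≤ 3 := by rw [abs_le]; constructor <;> linarith [hv.1, hv.2]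
      nlinarith
    have hp : |u ^ k - v ^ k| ≤ |u - v| * k := by
      refine (abs_pow_sub_pow_le u v k).trans ?_
      refine mul_le_of_le_one_right (by positivity) (pow_le_one₀ (by positivity) ?_)
      exact max_le (abs_le.2 hu) (abs_le.2 hv)
    calc |u ^ k * K u - v ^ k * K v| = |u ^ k * (K u - K v) + (u ^ k - v ^ k) * K v| := by ring_nf
      _ ≤ |u ^ k| * |K u - K v| + |u ^ k - v ^ k| * |K v| := by
        rw [← abs_mul, ← abs_mul]; exact abs_add_le _ _
      _ ≤ 1 * (L * |u - v|) + |u - v| * k * (3 * L) := by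
        gcongr
        · exact hpow u hu
        · exact hlip u v
      _ = ((3 * k + 1) * L) * |u - v| := by ring
  · rw [hsupp v hv, mul_zero, sub_zero]; exact hout u v hu hv
  · rw [hsupp u hu, mul_zero, zero_sub, abs_neg, abs_sub_comm]; exact hout v u hv hu
  · rw [hsupp u hu, hsupp v hv]; simp; positivity

/-- The rescaled design points `(x_j − x) / h`. -/
noncomputable def gridPt (x h : ℝ) (N : ℕ) (j : ℕ) : ℝ := (xdEq N (j + 1) - x) / h

/-- Riemann-sum weights `u_j ^ k K(u_j) / ((N − 1) h)` at the rescaled design points `u_j`. -/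
noncomputable def momWeight (K : ℝ → ℝ) (x h : ℝ) (N k : ℕ) (j : ℕ) : ℝ :=
  (((N : ℝ) - 1) * h)⁻¹ * (gridPt x h N j ^ k * K (gridPt x h N j))

/-- The discrete counterpart of the kernel moment `kmom K k`. -/
noncomputable def discMom (K : ℝ → ℝ) (x h : ℝ) (N k : ℕ) : ℝ :=
  ∑ j : Fin N, momWeight K x h N k j

/-- The discrete counterpart of `Smat K p`. -/
noncomputable def discSmat (K : ℝ → ℝ) (x h : ℝ) (p N : ℕ) :
    Matrix (Fin (p + 1)) (Fin (p + 1)) ℝ :=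
  Matrix.of fun k l => discMom K x h N ((k : ℕ) + (l : ℕ))

/-- The weights of the local polynomial estimator, rescaled by `h ^ ν`. -/
noncomputable def effWeight (K : ℝ → ℝ) (x h : ℝ) (p N : ℕ) (ν : Fin (p + 1)) (j : ℕ) : ℝ :=
  ∑ k : Fin (p + 1), (discSmat K x h p N)⁻¹ ν k * momWeight K x h N k j

theorem discSmat_transpose (K : ℝ → ℝ) (x h : ℝ) (p N : ℕ) :
    (discSmat K x h p N)ᵀ = discSmat K x h p N := by
  ext k l
  simp [discSmat, add_comm]

theorem Xmat_transpose_mul_Wmat (K : ℝ → ℝ) (x : ℝ) {h : ℝ} (p : ℕ) {N : ℕ}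
    (hh : h ≠ 0) (hN : (N : ℝ) - 1 ≠ 0) :
    (Xmat xdEq x p N)ᵀ * Wmat K xdEq x h N =
      diagonal (fun k : Fin (p + 1) => ((N : ℝ) - 1) * h ^ (k : ℕ)) *
        Matrix.of fun (k : Fin (p + 1)) (j : Fin N) => momWeight K x h N k j := by
  ext k j
  simp only [Wmat, Xmat, mul_diagonal, diagonal_mul, transpose_apply, of_apply, momWeight, gridPt,
    div_pow]
  field_simp

theorem Wmat_mul_Xmat (K : ℝ → ℝ) (x : ℝ) {h : ℝ} (p : ℕ) {N : ℕ}
    (hh : h ≠ 0) (hN : (N : ℝ) - 1 ≠ 0) :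
    Wmat K xdEq x h N * Xmat xdEq x p N =
      (Matrix.of fun (k : Fin (p + 1)) (j : Fin N) => momWeight K x h N k j)ᵀ *
        diagonal (fun k : Fin (p + 1) => ((N : ℝ) - 1) * h ^ (k : ℕ)) := by
  have := congrArg transpose (Xmat_transpose_mul_Wmat K x p hh hN)
  simpa [transpose_mul, Wmat, diagonal_transpose] using this

theorem gram_eq (K : ℝ → ℝ) (x : ℝ) {h : ℝ} (p : ℕ) {N : ℕ} (hh : h ≠ 0) (hN : (N : ℝ) - 1 ≠ 0) :
    (Xmat xdEq x p N)ᵀ * Wmat K xdEq x h N * Xmat xdEq x p N =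
      diagonal (fun k : Fin (p + 1) => ((N : ℝ) - 1) * h ^ (k : ℕ)) * discSmat K x h p N *
        diagonal (fun k : Fin (p + 1) => h ^ (k : ℕ)) := by
  rw [Xmat_transpose_mul_Wmat K x p hh hN, Matrix.mul_assoc, Matrix.mul_assoc]
  congr 1
  ext k l
  rw [Matrix.mul_diagonal, Matrix.mul_apply]
  simp only [discSmat, discMom, Xmat, of_apply, Finset.sum_mul]
  refine Finset.sum_congr rfl fun j _ => ?_
  have : xdEq N (j + 1) - x = gridPt x h N j * h := by rw [gridPt]; field_simp
  rw [this, momWeight, momWeight, mul_pow, pow_add]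
  ring

theorem isUnit_det_diagonal {m : ℕ} {d : Fin m → ℝ} (hd : ∀ i, d i ≠ 0) :
    IsUnit (diagonal d).det := by
  rw [det_diagonal]
  exact (Finset.prod_ne_zero_iff.2 fun i _ => hd i).isUnit

theorem isUnit_det_gram (K : ℝ → ℝ) (x : ℝ) {h : ℝ} (p : ℕ) {N : ℕ} (hh : h ≠ 0)
    (hN : (N : ℝ) - 1 ≠ 0) (hS : IsUnit (discSmat K x h p N).det) :
    IsUnit ((Xmat xdEq x p N)ᵀ * Wmat K xdEq x h N * Xmat xdEq x p N).det := by
  rw [gram_eq K x p hh hN, det_mul, det_mul]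
  exact ((isUnit_det_diagonal fun k => mul_ne_zero hN (pow_ne_zero _ hh)).mul hS).mul
    (isUnit_det_diagonal fun k => pow_ne_zero _ hh)

/-- The rescaled variance as a quadratic form in the effective weights. -/
theorem pow_mul_VN_eq (K : ℝ → ℝ) (ρ : ℝ → ℝ → ℝ) (x : ℝ) {h : ℝ} (p : ℕ) {N : ℕ}
    (ν : Fin (p + 1)) (hh : h ≠ 0) (hN : (N : ℝ) - 1 ≠ 0) :
    h ^ (2 * (ν : ℕ)) * VN K xdEq ρ x h p N ν =
      ∑ i : Fin N, ∑ j : Fin N, effWeight K x h p N ν i * effWeight K x h p N ν j *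
        ρ (xdEq N (i + 1)) (xdEq N (j + 1)) := by
  set D := diagonal (fun k : Fin (p + 1) => h ^ (k : ℕ)) with hD
  set D' := diagonal (fun k : Fin (p + 1) => ((N : ℝ) - 1) * h ^ (k : ℕ)) with hD'
  set Y : Matrix (Fin (p + 1)) (Fin N) ℝ := Matrix.of fun k j => momWeight K x h N k j with hY
  set S := discSmat K x h p N with hS
  have hDu : IsUnit D.det := isUnit_det_diagonal fun k => pow_ne_zero _ hh
  have hDu' : IsUnit D'.det := isUnit_det_diagonal fun k => mul_ne_zero hN (pow_ne_zero _ hh)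
  have hcomm : D' * S * D = D * S * D' := by
    ext k l
    simp only [hD, hD', mul_diagonal, diagonal_mul]
    ring
  have hinv : (D' * S * D)⁻¹ = D⁻¹ * S⁻¹ * D'⁻¹ := by
    rw [Matrix.mul_inv_rev, Matrix.mul_inv_rev, Matrix.mul_assoc]
  have hinv' : (D' * S * D)⁻¹ = D'⁻¹ * S⁻¹ * D⁻¹ := by
    rw [hcomm, Matrix.mul_inv_rev, Matrix.mul_inv_rev, Matrix.mul_assoc]
  have hSt : (S⁻¹)ᵀ = S⁻¹ := by rw [transpose_nonsing_inv, hS, discSmat_transpose]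
  have hmat : (D' * S * D)⁻¹ * (D' * Y) * Sigmat ρ xdEq N * (Yᵀ * D') * (D' * S * D)⁻¹ =
      D⁻¹ * ((S⁻¹ * Y) * Sigmat ρ xdEq N * (S⁻¹ * Y)ᵀ) * D⁻¹ := by
    have e1 : (D' * S * D)⁻¹ * (D' * Y) = D⁻¹ * (S⁻¹ * Y) := by
      rw [hinv, Matrix.mul_assoc, Matrix.nonsing_inv_mul_cancel_left _ _ hDu', Matrix.mul_assoc]
    have e2 : (Yᵀ * D') * (D' * S * D)⁻¹ = (S⁻¹ * Y)ᵀ * D⁻¹ := by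
      rw [hinv', Matrix.mul_assoc, Matrix.mul_assoc, Matrix.mul_nonsing_inv_cancel_left _ _ hDu',
        transpose_mul, hSt, Matrix.mul_assoc]
    rw [e1, Matrix.mul_assoc, e2]
    simp only [Matrix.mul_assoc]
  have hDinv : D⁻¹ = diagonal (fun k : Fin (p + 1) => (h ^ (k : ℕ))⁻¹) := by
    refine Matrix.inv_eq_right_inv ?_
    rw [hD, diagonal_mul_diagonal, ← diagonal_one]
    congr 1
    ext k
    exact mul_inv_cancel₀ (pow_ne_zero _ hh)
  rw [VN, Wmat_mul_Xmat K x p hh hN, gram_eq K x p hh hN, Xmat_transpose_mul_Wmat K x p hh hN,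
    hmat, hDinv, mul_diagonal, diagonal_mul]
  have hpow : h ^ (2 * (ν : ℕ)) = h ^ (ν : ℕ) * h ^ (ν : ℕ) := by rw [two_mul, pow_add]
  have hcancel : ∀ a : ℝ, h ^ (2 * (ν : ℕ)) * ((h ^ (ν : ℕ))⁻¹ * a * (h ^ (ν : ℕ))⁻¹) = a := by
    intro a
    rw [hpow]
    field_simp
  rw [hcancel, Matrix.mul_apply, Finset.sum_comm]
  refine Finset.sum_congr rfl fun j _ => ?_
  rw [Matrix.mul_apply, Finset.sum_mul]
  refine Finset.sum_congr rfl fun i _ => ?_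
  simp only [transpose_apply, Matrix.mul_apply, hY, of_apply, Sigmat, effWeight, ← hS]
  ring

theorem sum_effWeight_mul_pow (K : ℝ → ℝ) (x h : ℝ) (p N : ℕ) (ν : Fin (p + 1)) (a : ℕ) :
    ∑ j : Fin N, effWeight K x h p N ν j * gridPt x h N j ^ a =
      ∑ k : Fin (p + 1), (discSmat K x h p N)⁻¹ ν k * discMom K x h N ((k : ℕ) + a) := by
  simp only [effWeight, discMom, Finset.sum_mul, Finset.mul_sum]
  rw [Finset.sum_comm]
  refine Finset.sum_congr rfl fun k _ => Finset.sum_congr rfl fun j _ => ?_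
  rw [momWeight, momWeight, pow_add]
  ring

/-- Accuracy of the discrete kernel moments. -/
theorem abs_discMom_sub_kmom_le {K : ℝ → ℝ} {L : NNReal} (hK : LipschitzWith L K)
    (hsupp : ∀ u, u ∉ Icc (-1 : ℝ) 1 → K u = 0) (k : ℕ) {x h : ℝ} {N : ℕ} (hh : 0 < h)
    (hhx : h < x) (hhx' : h < 1 - x) (hN : 2 ≤ N) :
    |discMom K x h N k - kmom K k| ≤
      ((3 * k + 1) * L) * (((N : ℝ) - 1) * h)⁻¹ * (2 + 2 * (((N : ℝ) - 1) * h)⁻¹) := by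
  obtain ⟨n, rfl⟩ : ∃ n, N = n + 1 := ⟨N - 1, by omega⟩
  have hn : (0 : ℝ) < n := by exact_mod_cast (by omega : 0 < n)
  have hn1 : ((n + 1 : ℕ) : ℝ) - 1 = n := by push_cast; ring
  have hgrid : ∀ j : ℕ, gridPt x h (n + 1) j = (j / n - x) / h := by
    intro j
    rw [gridPt, xdEq, hn1]
    push_cast
    ring
  have han : 1 < gridPt x h (n + 1) n := by
    rw [hgrid, div_self hn.ne', lt_div_iff₀ hh]
    linarith
  have hlast : momWeight K x h (n + 1) k n = 0 := by
    rw [momWeight, hsupp _ fun hmem => absurd hmem.2 (not_le.2 han)]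
    ring
  have hsum : discMom K x h (n + 1) k = ((((n + 1 : ℕ) : ℝ) - 1) * h)⁻¹ *
      ∑ j ∈ Finset.range n, gridPt x h (n + 1) j ^ k * K (gridPt x h (n + 1) j) := by
    rw [discMom, Fin.sum_univ_eq_sum_range (fun j => momWeight K x h (n + 1) k j),
      Finset.sum_range_succ, hlast, add_zero, Finset.mul_sum]
    rfl
  have hcont := hK.continuous
  rw [hsum, kmom]
  refine abs_riemannSum_sub_integral_le (f := fun u => u ^ k * K u)
    (abs_pow_mul_sub_pow_mul_le hK hsupp k) (fun u hu => by simp [hsupp u hu]) (by fun_prop)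
    (by rw [hn1]; positivity) (fun j => ?_) ?_ han
  · rw [hgrid, hgrid, hn1]
    push_cast
    field_simp
    ring
  · rw [hgrid, div_lt_iff₀ hh]
    simp
    linarith

theorem tendsto_mesh_div {hN : ℕ → ℝ} (hN0 : Tendsto hN atTop (𝓝 0))
    (hNh5 : Tendsto (fun N : ℕ => (N : ℝ) * hN N ^ 5) atTop atTop) :
    Tendsto (fun N : ℕ => (((N : ℝ) - 1) * hN N ^ 5)⁻¹) atTop (𝓝 0) := by
  refine Tendsto.inv_tendsto_atTop ?_
  have h5 : Tendsto (fun N => -hN N ^ 5) atTop (𝓝 0) := by simpa using (hN0.pow 5).neg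
  refine (hNh5.atTop_add h5).congr fun N => ?_
  ring

theorem isLittleO_mesh {hN : ℕ → ℝ} (hNpos : ∀ N, 0 < hN N) (hN0 : Tendsto hN atTop (𝓝 0))
    (hNh5 : Tendsto (fun N : ℕ => (N : ℝ) * hN N ^ 5) atTop atTop) :
    (fun N : ℕ => (((N : ℝ) - 1) * hN N)⁻¹) =o[atTop] fun N => hN N ^ 4 := by
  rw [Asymptotics.isLittleO_iff_tendsto fun N h => absurd h (pow_pos (hNpos N) 4).ne']
  refine (tendsto_mesh_div hN0 hNh5).congr fun N => ?_
  rw [div_eq_mul_inv, ← mul_inv]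
  ring

theorem tendsto_pow_four {hN : ℕ → ℝ} (hN0 : Tendsto hN atTop (𝓝 0)) :
    Tendsto (fun N => hN N ^ 4) atTop (𝓝 0) := by
  simpa using hN0.pow 4

theorem discMom_sub_kmom_isLittleO {K : ℝ → ℝ} {L : NNReal} (hK : LipschitzWith L K)
    (hsupp : ∀ u, u ∉ Icc (-1 : ℝ) 1 → K u = 0) {x : ℝ} (hx : x ∈ Ioo (0 : ℝ) 1)
    {hN : ℕ → ℝ} (hNpos : ∀ N, 0 < hN N) (hN0 : Tendsto hN atTop (𝓝 0))
    (hNh5 : Tendsto (fun N : ℕ => (N : ℝ) * hN N ^ 5) atTop atTop) (k : ℕ) :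
    (fun N => discMom K x (hN N) N k - kmom K k) =o[atTop] fun N => hN N ^ 4 := by
  have hmesh := isLittleO_mesh hNpos hN0 hNh5
  have hmesh0 := hmesh.trans_tendsto (tendsto_pow_four hN0)
  refine Asymptotics.IsBigO.trans_isLittleO ?_ hmesh
  refine Asymptotics.IsBigO.of_bound (((3 * k + 1) * L) * 4) ?_
  filter_upwards [hN0.eventually (gt_mem_nhds hx.1),
    hN0.eventually (gt_mem_nhds (sub_pos.2 hx.2)), eventually_ge_atTop 2,
    hmesh0.eventually (gt_mem_nhds zero_lt_one)] with N h1 h2 h3 h4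
  have hN1 : (0 : ℝ) < (N : ℝ) - 1 := by
    have : (2 : ℝ) ≤ N := by exact_mod_cast h3
    linarith
  have hpos : 0 < (((N : ℝ) - 1) * hN N)⁻¹ := inv_pos.2 (mul_pos hN1 (hNpos N))
  rw [Real.norm_eq_abs, Real.norm_of_nonneg hpos.le]
  refine (abs_discMom_sub_kmom_le hK hsupp k (hNpos N) h1 h2 h3).trans ?_
  rw [mul_assoc _ (4 : ℝ), mul_assoc, mul_comm (4 : ℝ)]
  gcongr
  linarith

theorem tendsto_of_sub_isLittleO {u g : ℕ → ℝ} {a : ℝ} (hg : Tendsto g atTop (𝓝 0))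
    (hu : (fun N => u N - a) =o[atTop] g) : Tendsto u atTop (𝓝 a) :=
  tendsto_sub_nhds_zero_iff.1 (hu.trans_tendsto hg)

theorem mul_sub_mul_isLittleO {u v g : ℕ → ℝ} {a b : ℝ} (hg : Tendsto g atTop (𝓝 0))
    (hu : (fun N => u N - a) =o[atTop] g) (hv : (fun N => v N - b) =o[atTop] g) :
    (fun N => u N * v N - a * b) =o[atTop] g := by
  have h1 : (fun N => (u N - a) * v N) =o[atTop] g := by
    simpa using hu.mul_isBigO ((tendsto_of_sub_isLittleO hg hv).isBigO_one ℝ)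
  refine (h1.add (hv.const_mul_left a)).congr_left fun N => ?_
  ring

theorem discSmat_tendsto {K : ℝ → ℝ} {x : ℝ} {hN g : ℕ → ℝ} (p : ℕ) (hg : Tendsto g atTop (𝓝 0))
    (hmom : ∀ k, (fun N => discMom K x (hN N) N k - kmom K k) =o[atTop] g) :
    Tendsto (fun N => discSmat K x (hN N) p N) atTop (𝓝 (Smat K p)) := by
  refine tendsto_pi_nhds.2 fun k => tendsto_pi_nhds.2 fun l => ?_
  exact tendsto_of_sub_isLittleO hg (hmom _)

theorem eventually_isUnit_det_discSmat {K : ℝ → ℝ} {x : ℝ} {hN g : ℕ → ℝ} {p : ℕ}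
    (hg : Tendsto g atTop (𝓝 0)) (hS : IsUnit (Smat K p).det)
    (hmom : ∀ k, (fun N => discMom K x (hN N) N k - kmom K k) =o[atTop] g) :
    ∀ᶠ N in atTop, IsUnit (discSmat K x (hN N) p N).det := by
  have h1 : Tendsto (fun N => (discSmat K x (hN N) p N).det) atTop (𝓝 (Smat K p).det) :=
    ((continuous_id.matrix_det).tendsto (Smat K p)).comp (discSmat_tendsto p hg hmom)
  filter_upwards [h1.eventually_ne hS.ne_zero] with N hN
  exact hN.isUnit

theorem discSmat_inv_sub_isLittleO {K : ℝ → ℝ} {x : ℝ} {hN g : ℕ → ℝ} {p : ℕ}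
    (hg : Tendsto g atTop (𝓝 0)) (hS : IsUnit (Smat K p).det)
    (hmom : ∀ k, (fun N => discMom K x (hN N) N k - kmom K k) =o[atTop] g)
    (k l : Fin (p + 1)) :
    (fun N => (discSmat K x (hN N) p N)⁻¹ k l - (Smat K p)⁻¹ k l) =o[atTop] g := by
  have hinv : Tendsto (fun N => (discSmat K x (hN N) p N)⁻¹) atTop (𝓝 (Smat K p)⁻¹) := by
    have hc : ContinuousAt Ring.inverse (Smat K p).det := by
      obtain ⟨d, hd⟩ := hS
      rw [← hd]
      exact NormedRing.inverse_continuousAt d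
    exact (continuousAt_matrix_inv _ hc).tendsto.comp (discSmat_tendsto p hg hmom)
  have hentry : ∀ i j, Tendsto (fun N => (discSmat K x (hN N) p N)⁻¹ i j) atTop
      (𝓝 ((Smat K p)⁻¹ i j)) := fun i j =>
    tendsto_pi_nhds.1 (tendsto_pi_nhds.1 hinv i) j
  have hsum : (fun N => ∑ j, (∑ i, (discSmat K x (hN N) p N)⁻¹ k i *
      (discSmat K x (hN N) p N i j - Smat K p i j)) * (Smat K p)⁻¹ j l) =o[atTop] g := by
    refine Asymptotics.IsLittleO.fun_sum fun j _ => ?_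
    have : (fun N => ∑ i, (discSmat K x (hN N) p N)⁻¹ k i *
        (discSmat K x (hN N) p N i j - Smat K p i j)) =o[atTop] g := by
      refine Asymptotics.IsLittleO.fun_sum fun i _ => ?_
      have hb : (fun N => discSmat K x (hN N) p N i j - Smat K p i j) =o[atTop] g := hmom _
      simpa using ((hentry k i).isBigO_one ℝ).mul_isLittleO hb
    simpa [mul_comm] using this.const_mul_left ((Smat K p)⁻¹ j l)
  refine hsum.neg_left.congr' ?_ EventuallyEq.rfl
  filter_upwards [eventually_isUnit_det_discSmat hg hS hmom] with N hNu
  have hmat : (discSmat K x (hN N) p N)⁻¹ * (discSmat K x (hN N) p N - Smat K p) * (Smat K p)⁻¹ =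
      (Smat K p)⁻¹ - (discSmat K x (hN N) p N)⁻¹ := by
    rw [Matrix.mul_sub, Matrix.nonsing_inv_mul _ hNu, Matrix.sub_mul, Matrix.one_mul,
      Matrix.mul_nonsing_inv_cancel_right _ _ hS]
  have := congrFun (congrFun hmat k) l
  simp only [Matrix.mul_apply, Matrix.sub_apply] at this
  rw [this]
  ring

/-- The moments `e_νᵀ S⁻¹ (μ_{k+a})_k` of the equivalent kernel. -/
noncomputable def eqMom (K : ℝ → ℝ) (p : ℕ) (ν : Fin (p + 1)) (a : ℕ) : ℝ :=
  ∑ k : Fin (p + 1), (Smat K p)⁻¹ ν k * kmom K ((k : ℕ) + a)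

theorem sum_effWeight_mul_pow_sub_isLittleO {K : ℝ → ℝ} {x : ℝ} {hN g : ℕ → ℝ} {p : ℕ}
    (hg : Tendsto g atTop (𝓝 0)) (hS : IsUnit (Smat K p).det)
    (hmom : ∀ k, (fun N => discMom K x (hN N) N k - kmom K k) =o[atTop] g)
    (ν : Fin (p + 1)) (a : ℕ) :
    (fun N => ∑ j : Fin N, effWeight K x (hN N) p N ν j * gridPt x (hN N) N j ^ a
      - eqMom K p ν a) =o[atTop] g := by
  have := Asymptotics.IsLittleO.fun_sum (s := Finset.univ) fun (k : Fin (p + 1)) _ =>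
    mul_sub_mul_isLittleO hg (discSmat_inv_sub_isLittleO hg hS hmom ν k) (hmom ((k : ℕ) + a))
  refine this.congr_left fun N => ?_
  rw [sum_effWeight_mul_pow, eqMom, Finset.sum_sub_distrib]

theorem kmom_eq_zero_of_odd {K : ℝ → ℝ} (hsym : ∀ u, K (-u) = K u) {k : ℕ} (hk : Odd k) :
    kmom K k = 0 := by
  have h1 : kmom K k = -kmom K k := by
    unfold kmom
    conv_lhs => rw [← neg_neg (1 : ℝ), ← intervalIntegral.integral_comp_neg]
    rw [neg_neg, ← intervalIntegral.integral_neg]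
    refine intervalIntegral.integral_congr fun u _ => ?_
    simp [hsym, hk.neg_pow]
  linarith

theorem Smat_transpose (K : ℝ → ℝ) (p : ℕ) : (Smat K p)ᵀ = Smat K p := by
  ext k l
  simp [Smat, add_comm]

theorem Smat_inv_comm (K : ℝ → ℝ) (p : ℕ) (k l : Fin (p + 1)) :
    (Smat K p)⁻¹ k l = (Smat K p)⁻¹ l k := by
  conv_lhs => rw [← Smat_transpose, ← transpose_nonsing_inv]
  rfl

theorem Smat_inv_eq_zero_of_odd {K : ℝ → ℝ} (hsym : ∀ u, K (-u) = K u) {p : ℕ}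
    (k l : Fin (p + 1)) (hkl : Odd ((k : ℕ) + (l : ℕ))) : (Smat K p)⁻¹ k l = 0 := by
  set D := diagonal (fun k : Fin (p + 1) => (-1 : ℝ) ^ (k : ℕ)) with hD
  have hDD : D * D = 1 := by
    rw [hD, diagonal_mul_diagonal, ← diagonal_one]
    congr 1
    ext i
    rw [← mul_pow]
    simp
  have hDinv : D⁻¹ = D := Matrix.inv_eq_right_inv hDD
  have hSD : D * Smat K p * D = Smat K p := by
    ext i j
    simp only [hD, mul_diagonal, diagonal_mul, Smat, of_apply]
    rcases Nat.even_or_odd ((i : ℕ) + (j : ℕ)) with he | ho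
    · rw [mul_right_comm, ← pow_add, he.neg_one_pow, one_mul]
    · rw [kmom_eq_zero_of_odd hsym ho]
      ring
  have hinv := congrArg (fun M => M⁻¹ k l) hSD
  simp only [Matrix.mul_inv_rev, hDinv] at hinv
  simp only [hD, mul_diagonal, diagonal_mul] at hinv
  have h1 : (-1 : ℝ) ^ (k : ℕ) * ((-1) ^ (l : ℕ)) = -1 := by rw [← pow_add, hkl.neg_one_pow]
  have h2 : (-1 : ℝ) ^ (k : ℕ) * ((Smat K p)⁻¹ k l * (-1) ^ (l : ℕ)) =
    ((-1 : ℝ) ^ (k : ℕ) * ((-1) ^ (l : ℕ))) * (Smat K p)⁻¹ k l := by ring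
  rw [h2, h1] at hinv
  linarith

theorem eqMom_eq_zero {K : ℝ → ℝ} (hsym : ∀ u, K (-u) = K u) {p : ℕ} {ν : Fin (p + 1)}
    (hν : Odd (ν : ℕ)) {a : ℕ} (ha : Even a) : eqMom K p ν a = 0 := by
  refine Finset.sum_eq_zero fun k _ => ?_
  rcases Nat.even_or_odd (k : ℕ) with he | ho
  · rw [Smat_inv_eq_zero_of_odd hsym ν k (hν.add_even he), zero_mul]
  · rw [kmom_eq_zero_of_odd hsym (ho.add_even ha), mul_zero]

theorem Smat_inv_mul_rankOne_mul (K : ℝ → ℝ) (p : ℕ) (ν : Fin (p + 1)) (a b : ℕ) :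
    ((Smat K p)⁻¹ * (Matrix.of fun k l : Fin (p + 1) =>
      kmom K ((k : ℕ) + a) * kmom K ((l : ℕ) + b)) * (Smat K p)⁻¹) ν ν =
      eqMom K p ν a * eqMom K p ν b := by
  simp only [Matrix.mul_apply, of_apply, eqMom, Finset.sum_mul_sum]
  simp only [Finset.sum_mul]
  rw [Finset.sum_comm]
  refine Finset.sum_congr rfl fun k _ => Finset.sum_congr rfl fun l _ => ?_
  rw [Smat_inv_comm K p ν l]
  ring

theorem sum_sum_mul_taylorPoly₂ {ι : Type*} [Fintype ι] (ρ : ℝ → ℝ → ℝ) (x h : ℝ) (n : ℕ)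
    (β u : ι → ℝ) :
    ∑ i, ∑ j, β i * β j * taylorPoly₂ ρ x n (h * u i) (h * u j) =
      ∑ b ∈ Finset.range (n + 1), ∑ a ∈ Finset.range (n + 1 - b),
        mixedPD ρ a b x / (a.factorial * b.factorial) *
          (h ^ (a + b) * ((∑ i, β i * u i ^ a) * ∑ j, β j * u j ^ b)) := by
  simp only [taylorPoly₂, Finset.sum_mul_sum]
  simp only [Finset.mul_sum]
  rw [Finset.sum_congr rfl fun i _ => Finset.sum_comm, Finset.sum_comm]
  refine Finset.sum_congr rfl fun b _ => ?_
  rw [Finset.sum_congr rfl fun i _ => Finset.sum_comm, Finset.sum_comm]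
  refine Finset.sum_congr rfl fun a _ => Finset.sum_congr rfl fun i _ =>
    Finset.sum_congr rfl fun j _ => ?_
  ring

theorem effWeight_eq_zero {K : ℝ → ℝ} (hsupp : ∀ u, u ∉ Icc (-1 : ℝ) 1 → K u = 0) {x h : ℝ}
    {p N : ℕ} (ν : Fin (p + 1)) {j : ℕ} (hj : gridPt x h N j ∉ Icc (-1 : ℝ) 1) :
    effWeight K x h p N ν j = 0 := by
  simp [effWeight, momWeight, hsupp _ hj]

theorem sum_abs_effWeight_le {K : ℝ → ℝ} (hKnn : ∀ u, 0 ≤ K u)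
    (hsupp : ∀ u, u ∉ Icc (-1 : ℝ) 1 → K u = 0) {x h : ℝ} (hh : 0 < h) {p N : ℕ} (hN : 2 ≤ N)
    (ν : Fin (p + 1)) :
    ∑ j : Fin N, |effWeight K x h p N ν j| ≤
      (∑ k : Fin (p + 1), |(discSmat K x h p N)⁻¹ ν k|) * discMom K x h N 0 := by
  rw [discMom, Finset.mul_sum]
  refine Finset.sum_le_sum fun j _ => ?_
  rw [effWeight, Finset.sum_mul]
  refine (Finset.abs_sum_le_sum_abs _ _).trans (Finset.sum_le_sum fun k _ => ?_)
  rw [abs_mul]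
  gcongr
  have hN1 : (0 : ℝ) < (N : ℝ) - 1 := by
    have : (2 : ℝ) ≤ N := by exact_mod_cast hN
    linarith
  rw [momWeight, momWeight, abs_mul, abs_of_pos (inv_pos.2 (mul_pos hN1 hh)), abs_mul,
    abs_of_nonneg (hKnn _)]
  by_cases hu : gridPt x h N j ∈ Icc (-1 : ℝ) 1
  · rw [abs_pow, pow_zero]
    have := hKnn (gridPt x h N j)
    gcongr
    exact pow_le_one₀ (abs_nonneg _) (abs_le.2 hu)
  · simp [hsupp _ hu]

theorem sum_abs_effWeight_isBigO_one {K : ℝ → ℝ} (hKnn : ∀ u, 0 ≤ K u)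
    (hsupp : ∀ u, u ∉ Icc (-1 : ℝ) 1 → K u = 0) {x : ℝ} {hN g : ℕ → ℝ} (hNpos : ∀ N, 0 < hN N)
    {p : ℕ} (hg : Tendsto g atTop (𝓝 0)) (hS : IsUnit (Smat K p).det)
    (hmom : ∀ k, (fun N => discMom K x (hN N) N k - kmom K k) =o[atTop] g) (ν : Fin (p + 1)) :
    (fun N => ∑ j : Fin N, |effWeight K x (hN N) p N ν j|) =O[atTop] fun _ => (1 : ℝ) := by
  have h1 : Tendsto (fun N => (∑ k : Fin (p + 1), |(discSmat K x (hN N) p N)⁻¹ ν k|) *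
      discMom K x (hN N) N 0) atTop (𝓝 ((∑ k : Fin (p + 1), |(Smat K p)⁻¹ ν k|) * kmom K 0)) :=
    (tendsto_finsetSum _ fun k _ => (tendsto_of_sub_isLittleO hg
      (discSmat_inv_sub_isLittleO hg hS hmom ν k)).abs).mul
      (tendsto_of_sub_isLittleO hg (hmom 0))
  refine Asymptotics.IsBigO.trans (Asymptotics.IsBigO.of_bound 1 ?_) (h1.isBigO_one ℝ)
  filter_upwards [eventually_ge_atTop 2] with N hN2
  rw [one_mul, Real.norm_of_nonneg (Finset.sum_nonneg fun _ _ => abs_nonneg _)]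
  exact (sum_abs_effWeight_le hKnn hsupp (hNpos N) hN2 ν).trans (le_abs_self _)

/-- Replacing the covariance by its Taylor polynomial is negligible. -/
theorem taylor_remainder_isLittleO {K : ℝ → ℝ} (hKnn : ∀ u, 0 ≤ K u)
    (hsupp : ∀ u, u ∉ Icc (-1 : ℝ) 1 → K u = 0) {ρ : ℝ → ℝ → ℝ} {x : ℝ} {n : ℕ}
    (hρ : ContDiffAt ℝ n (fun q : ℝ × ℝ => ρ q.1 q.2) (x, x))
    {hN g : ℕ → ℝ} (hNpos : ∀ N, 0 < hN N) (hN0 : Tendsto hN atTop (𝓝 0))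
    {p : ℕ} (hg : Tendsto g atTop (𝓝 0)) (hS : IsUnit (Smat K p).det)
    (hmom : ∀ k, (fun N => discMom K x (hN N) N k - kmom K k) =o[atTop] g) (ν : Fin (p + 1)) :
    (fun N => ∑ i : Fin N, ∑ j : Fin N, effWeight K x (hN N) p N ν i *
      effWeight K x (hN N) p N ν j * (ρ (xdEq N (i + 1)) (xdEq N (j + 1)) -
        taylorPoly₂ ρ x n (hN N * gridPt x (hN N) N i) (hN N * gridPt x (hN N) N j)))
      =o[atTop] fun N => hN N ^ n := by
  have hB := sum_abs_effWeight_isBigO_one hKnn hsupp hNpos hg hS hmom ν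
  have hBB : (fun N => hN N ^ n * ((∑ j : Fin N, |effWeight K x (hN N) p N ν j|) *
      ∑ j : Fin N, |effWeight K x (hN N) p N ν j|)) =O[atTop] fun N => hN N ^ n := by
    simpa using (Asymptotics.isBigO_refl (fun N => hN N ^ n) atTop).mul (hB.mul hB)
  refine Asymptotics.IsLittleO.trans_isBigO (Asymptotics.isLittleO_iff.2 fun ε hε => ?_) hBB
  obtain ⟨r, hr, hball⟩ := Metric.eventually_nhds_iff_ball.1
    (Asymptotics.isLittleO_iff.1 (hρ.taylorPoly₂_isLittleO n) hε)
  filter_upwards [hN0.eventually (gt_mem_nhds hr)] with N hNr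
  have hh := hNpos N
  rw [Real.norm_eq_abs, Real.norm_of_nonneg (by positivity), Finset.sum_mul_sum, Finset.mul_sum,
    Finset.mul_sum]
  refine (Finset.abs_sum_le_sum_abs _ _).trans (Finset.sum_le_sum fun i _ => ?_)
  rw [Finset.mul_sum, Finset.mul_sum]
  refine (Finset.abs_sum_le_sum_abs _ _).trans (Finset.sum_le_sum fun j _ => ?_)
  by_cases hi : gridPt x (hN N) N i ∈ Icc (-1 : ℝ) 1
  swap
  · simp [effWeight_eq_zero hsupp ν hi]
  by_cases hj : gridPt x (hN N) N j ∈ Icc (-1 : ℝ) 1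
  swap
  · simp [effWeight_eq_zero hsupp ν hj]
  have hpt : ∀ k : ℕ, hN N * gridPt x (hN N) N k = xdEq N (k + 1) - x := fun k => by
    rw [gridPt]
    field_simp
  have hle : ∀ k : ℕ, gridPt x (hN N) N k ∈ Icc (-1 : ℝ) 1 → |xdEq N (k + 1) - x| ≤ hN N := by
    intro k hk
    rw [← hpt, abs_mul, abs_of_pos hh]
    exact mul_le_of_le_one_right hh.le (abs_le.2 hk)
  have hnorm : ‖((xdEq N (i + 1), xdEq N (j + 1)) : ℝ × ℝ) - (x, x)‖ ≤ hN N :=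
    max_le (hle i hi) (hle j hj)
  have hrem := hball (xdEq N (i + 1), xdEq N (j + 1))
    (by rw [mem_ball_iff_norm]; exact hnorm.trans_lt hNr)
  rw [Real.norm_eq_abs, norm_pow, norm_norm] at hrem
  rw [hpt, hpt, abs_mul, abs_mul]
  have hrem' : |ρ (xdEq N (i + 1)) (xdEq N (j + 1)) -
      taylorPoly₂ ρ x n (xdEq N (i + 1) - x) (xdEq N (j + 1) - x)| ≤ ε * hN N ^ n :=
    hrem.trans (by gcongr)
  refine (mul_le_mul_of_nonneg_left hrem' (by positivity)).trans (le_of_eq ?_)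
  ring

/-- Expansion of the rescaled variance in terms of the moments of the equivalent kernel. -/
theorem pow_mul_VN_sub_isLittleO {K : ℝ → ℝ} (hKnn : ∀ u, 0 ≤ K u)
    (hsupp : ∀ u, u ∉ Icc (-1 : ℝ) 1 → K u = 0) {ρ : ℝ → ℝ → ℝ} {x : ℝ} {n : ℕ}
    (hρ : ContDiffAt ℝ n (fun q : ℝ × ℝ => ρ q.1 q.2) (x, x))
    {hN : ℕ → ℝ} (hNpos : ∀ N, 0 < hN N) (hN0 : Tendsto hN atTop (𝓝 0))
    {p : ℕ} (hg : Tendsto (fun N => hN N ^ n) atTop (𝓝 0)) (hS : IsUnit (Smat K p).det)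
    (hmom : ∀ k, (fun N => discMom K x (hN N) N k - kmom K k) =o[atTop] fun N => hN N ^ n)
    (ν : Fin (p + 1)) :
    (fun N => hN N ^ (2 * (ν : ℕ)) * VN K xdEq ρ x (hN N) p N ν -
      ∑ b ∈ Finset.range (n + 1), ∑ a ∈ Finset.range (n + 1 - b),
        mixedPD ρ a b x / (a.factorial * b.factorial) *
          (hN N ^ (a + b) * (eqMom K p ν a * eqMom K p ν b))) =o[atTop] fun N => hN N ^ n := by
  have hw := sum_effWeight_mul_pow_sub_isLittleO hg hS hmom ν
  have hpoly : (fun N => ∑ b ∈ Finset.range (n + 1), ∑ a ∈ Finset.range (n + 1 - b),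
      mixedPD ρ a b x / (a.factorial * b.factorial) * (hN N ^ (a + b) *
        ((∑ j : Fin N, effWeight K x (hN N) p N ν j * gridPt x (hN N) N j ^ a) *
          (∑ j : Fin N, effWeight K x (hN N) p N ν j * gridPt x (hN N) N j ^ b)
            - eqMom K p ν a * eqMom K p ν b))) =o[atTop] fun N => hN N ^ n := by
    refine Asymptotics.IsLittleO.fun_sum fun b _ => Asymptotics.IsLittleO.fun_sum fun a _ =>
      Asymptotics.IsLittleO.const_mul_left ?_ _
    simpa using ((hN0.pow (a + b)).isBigO_one ℝ).mul_isLittleO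
      (mul_sub_mul_isLittleO hg (hw a) (hw b))
  refine ((taylor_remainder_isLittleO hKnn hsupp hρ hNpos hN0 hg hS hmom ν).add hpoly).congr'
    ?_ EventuallyEq.rfl
  filter_upwards [eventually_ge_atTop 2] with N hN2
  have hN1 : (N : ℝ) - 1 ≠ 0 := by
    have : (2 : ℝ) ≤ N := by exact_mod_cast hN2
    linarith
  rw [pow_mul_VN_eq K ρ x p ν (hNpos N).ne' hN1]
  simp only [mul_sub, Finset.sum_sub_distrib]
  rw [sum_sum_mul_taylorPoly₂ ρ x (hN N) n (fun j : Fin N => effWeight K x (hN N) p N ν j)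
    (fun j : Fin N => gridPt x (hN N) N j)]
  ring

/-- Theorem 2 of the paper, case `ν` odd: higher-order variance
expansion for the equidistant design with a covariance four times continuously
differentiable near `(x,x)`. -/
theorem stmt_14 (K : ℝ → ℝ) (L : NNReal) (hKlip : LipschitzWith L K)
    (hKnn : ∀ u, 0 ≤ K u) (hKsym : ∀ u, K (-u) = K u)
    (hKint : (∫ u, K u) = 1)
    (hKsupp : ∀ u, u ∉ Icc (-1:ℝ) 1 → K u = 0)
    (ρ : ℝ → ℝ → ℝ)
    (hρc : ContinuousOn (fun q : ℝ × ℝ => ρ q.1 q.2) (Icc 0 1 ×ˢ Icc 0 1))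
    (hρsym : ∀ s t, s ∈ Icc (0:ℝ) 1 → t ∈ Icc (0:ℝ) 1 → ρ s t = ρ t s)
    (p : ℕ) (ν : Fin (p + 1)) (hν : Odd (ν : ℕ))
    (x : ℝ) (hx : x ∈ Ioo (0:ℝ) 1)
    (hρsm : ContDiffAt ℝ 4 (fun q : ℝ × ℝ => ρ q.1 q.2) (x, x))
    (hS : IsUnit (Smat K p).det)
    (hN : ℕ → ℝ) (hNpos : ∀ N, 0 < hN N)
    (hN0 : Tendsto hN atTop (𝓝 0))
    (hNh5 : Tendsto (fun N : ℕ => (N : ℝ) * hN N ^ 5) atTop atTop) :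
    (∀ᶠ N in atTop,
      IsUnit ((Xmat xdEq x p N)ᵀ * Wmat K xdEq x (hN N) N * Xmat xdEq x p N).det) ∧
    Tendsto (fun N : ℕ =>
        (hN N ^ (2 * (ν : ℕ)) * VN K xdEq ρ x (hN N) p N ν
          - hN N ^ 2 * mixedPD ρ 1 1 x *
              ((Smat K p)⁻¹ * A2mat K p * (Smat K p)⁻¹) ν ν
          - hN N ^ 4 * mixedPD ρ 1 3 x *
              ((Smat K p)⁻¹ * A3mat K p * (Smat K p)⁻¹) ν ν)
          / hN N ^ 4)
      atTop (𝓝 0) := by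
  have hg := tendsto_pow_four hN0
  have hmom := discMom_sub_kmom_isLittleO hKlip hKsupp hx hNpos hN0 hNh5
  constructor
  · filter_upwards [eventually_isUnit_det_discSmat hg hS hmom, eventually_ge_atTop 2] with N hu hN2
    have hN1 : (N : ℝ) - 1 ≠ 0 := by
      have : (2 : ℝ) ≤ N := by exact_mod_cast hN2
      linarith
    exact isUnit_det_gram K x p (hNpos N).ne' hN1 hu
  have hsym : ∀ᶠ q : ℝ × ℝ in 𝓝 (x, x), ρ q.1 q.2 = ρ q.2 q.1 := by
    filter_upwards [prod_mem_nhds (Icc_mem_nhds hx.1 hx.2) (Icc_mem_nhds hx.1 hx.2)] with q hq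
    exact hρsym q.1 q.2 hq.1 hq.2
  have h31 := mixedPD_three_one_eq hρsm hsym
  have hA2 : ((Smat K p)⁻¹ * A2mat K p * (Smat K p)⁻¹) ν ν = eqMom K p ν 1 * eqMom K p ν 1 :=
    Smat_inv_mul_rankOne_mul K p ν 1 1
  have hA3 : ((Smat K p)⁻¹ * A3mat K p * (Smat K p)⁻¹) ν ν =
      (eqMom K p ν 3 * eqMom K p ν 1 + eqMom K p ν 1 * eqMom K p ν 3) / 6 := by
    have hsplit : A3mat K p = (6 : ℝ)⁻¹ •
        ((Matrix.of fun k l : Fin (p + 1) => kmom K ((k : ℕ) + 3) * kmom K ((l : ℕ) + 1)) +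
          Matrix.of fun k l : Fin (p + 1) => kmom K ((k : ℕ) + 1) * kmom K ((l : ℕ) + 3)) := by
      ext k l
      simp only [A3mat, of_apply, Matrix.smul_apply, Matrix.add_apply, smul_eq_mul]
      ring
    rw [hsplit, Matrix.mul_smul, Matrix.smul_mul, Matrix.mul_add, Matrix.add_mul,
      Matrix.smul_apply, Matrix.add_apply, Smat_inv_mul_rankOne_mul, Smat_inv_mul_rankOne_mul,
      smul_eq_mul]
    ring
  rw [← Asymptotics.isLittleO_iff_tendsto fun N h => absurd h (pow_pos (hNpos N) 4).ne']
  refine (pow_mul_VN_sub_isLittleO (n := 4) hKnn hKsupp hρsm hNpos hN0 hg hS hmom ν).congr_left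
    fun N => ?_
  rw [hA2, hA3]
  have h0 : eqMom K p ν 0 = 0 := eqMom_eq_zero hKsym hν (by decide)
  have h2 : eqMom K p ν 2 = 0 := eqMom_eq_zero hKsym hν (by decide)
  have h4 : eqMom K p ν 4 = 0 := eqMom_eq_zero hKsym hν (by decide)
  simp [Finset.sum_range_succ, Nat.factorial, h0, h2, h4, h31]
  ring
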